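/- Let q be a power of 2, v a monic irreducible polynomial in 𝔽_q[t], n ≥ 1, and let s_1, …, s_n be integers with multiplicities k_1, …, k_n ≥ 1 and φ = k_1 + ⋯ + k_n. Assume that the integers s_1, …, s_n, together with 2s_i for each i with k_i > 1, are pairwise distinct and all q-even. Then Σ_{i : k_i > 1} Σ_{σ ∈ L(s_i*)} ζ_v(σ) + φ · Σ_{σ ∈ L(s_0)} ζ_v(σ) = 0 in K_v, where φ·x denotes the φ-fold sum of x (equal to x or 0 according as φ is odd or even, since K_v has characteristic 2). -/

import Mathlib

/-!
STATEMENT 1: Let q be a power of 2, v a monic irreducible polynomial in 𝔽_q[t], n ≥ 1, and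
let s₁, …, sₙ be integers with multiplicities k₁, …, kₙ ≥ 1 and φ = k₁ + ⋯ + kₙ. Assume that
the integers s₁, …, sₙ together with 2sᵢ for each i with kᵢ > 1 are pairwise distinct and all
q-even.  Then Σ_{i : kᵢ > 1} Σ_{σ ∈ L(sᵢ*)} ζ_v(σ) + φ · Σ_{σ ∈ L(s₀)} ζ_v(σ) = 0 in K_v.
-/

noncomputable section

open scoped Classical

/-- The height-one prime of `F[t]` attached to an irreducible polynomial `v`. -/
def heightOneOf {F : Type*} [Field F] (v : Polynomial F) (hv : Irreducible v) :
    IsDedekindDomain.HeightOneSpectrum (Polynomial F) where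
  asIdeal := Ideal.span {v}
  isPrime := (Ideal.span_singleton_prime hv.ne_zero).mpr hv.prime
  ne_bot := fun h => hv.ne_zero (Ideal.span_singleton_eq_bot.mp h)

/-- The `v`-adic completion `K_v` of `K = F(t)`. -/
def Kv {F : Type*} [Field F] (v : Polynomial F) (hv : Irreducible v) : Type _ :=
  (heightOneOf v hv).adicCompletion (RatFunc F)

instance {F : Type*} [Field F] (v : Polynomial F) (hv : Irreducible v) : Field (Kv v hv) :=
  inferInstanceAs (Field ((heightOneOf v hv).adicCompletion (RatFunc F)))

instance {F : Type*} [Field F] (v : Polynomial F) (hv : Irreducible v) :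
    UniformSpace (Kv v hv) :=
  inferInstanceAs (UniformSpace ((heightOneOf v hv).adicCompletion (RatFunc F)))

instance {F : Type*} [Field F] (v : Polynomial F) (hv : Irreducible v) :
    Algebra (RatFunc F) (Kv v hv) :=
  inferInstanceAs (Algebra (RatFunc F) ((heightOneOf v hv).adicCompletion (RatFunc F)))

/-- `S̃_d(k) = Σ_{a monic of degree d, v ∤ a} a^{-k} ∈ F(t)`. -/
def Stilde {F : Type*} [Field F] (v : Polynomial F) (d : ℕ) (k : ℤ) : RatFunc F :=
  ∑ᶠ a ∈ {a : Polynomial F | a.Monic ∧ a.natDegree = d ∧ ¬ v ∣ a},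
    (algebraMap (Polynomial F) (RatFunc F) a) ^ (-k)

/-- The general term of the series defining the `v`-adic multiple zeta value of the
tuple `w`, indexed by strictly decreasing tuples `d₁ > ⋯ > d_r ≥ 0`. -/
def zetavTerm {F : Type*} [Field F] (v : Polynomial F) (hv : Irreducible v) (w : List ℤ)
    (d : {d : Fin w.length → ℕ // StrictAnti d}) : Kv v hv :=
  algebraMap (RatFunc F) (Kv v hv) (∏ i, Stilde v (d.1 i) (w.get i))

/-- The `v`-adic multiple zeta value `ζ_v(s₁, …, s_r) ∈ K_v`. -/
def zetav {F : Type*} [Field F] (v : Polynomial F) (hv : Irreducible v) (w : List ℤ) :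
    Kv v hv :=
  ∑' d : {d : Fin w.length → ℕ // StrictAnti d}, zetavTerm v hv w d

/-- The tuple consisting of `c 1` copies of `s 1`, followed by `c 2` copies of `s 2`, …,
followed by `c n` copies of `s n`. -/
def mkTuple {S : Type*} {n : ℕ} (s : Fin n → S) (c : Fin n → ℕ) : List S :=
  (List.finRange n).flatMap fun j => List.replicate (c j) (s j)

/-- The sum of `f` over all distinct orderings (multiset permutations) of the tuple `u`,
each counted once. -/
def Lsum {α β : Type*} [AddCommMonoid β] (f : List α → β) (u : List α) : β :=
  ∑ᶠ w ∈ {w : List α | List.Perm w u}, f w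

section Comb
variable {R : Type*} [CommRing R]

/-- unit vector -/
def eZ (a : ℤ) : ℤ → ℤ := Pi.single a 1

def GG (f : ℕ → ℤ → R) (A : Finset ℤ) : ℕ → (ℤ → ℤ) → R
  | 0, M => if M = 0 then 1 else 0
  | N + 1, M => GG f A N M + ∑ a ∈ A, f N a * GG f A N (M - eZ a)

def HH (f : ℕ → ℤ → R) (A : Finset ℤ) (b : ℤ) : ℕ → (ℤ → ℤ) → R
  | 0, _ => 0
  | N + 1, M => HH f A b N M + f N b * GG f A N M + ∑ a ∈ A, f N a * HH f A b N (M - eZ a)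

theorem eZ_nonneg (a c : ℤ) : 0 ≤ eZ a c := by
  unfold eZ
  by_cases h : c = a
  · subst h; simp
  · simp [h]

theorem GG_neg (f : ℕ → ℤ → R) (A : Finset ℤ) (N : ℕ) (M : ℤ → ℤ) (c : ℤ) (hc : M c < 0) :
    GG f A N M = 0 := by
  induction N generalizing M with
  | zero =>
    have : M ≠ 0 := by rintro rfl; simp at hc
    simp [GG, this]
  | succ N ih =>
    rw [GG, ih M hc, zero_add]
    refine Finset.sum_eq_zero fun a _ => ?_
    rw [ih, mul_zero]
    have := eZ_nonneg a c
    simp only [Pi.sub_apply]; linarith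

theorem HH_neg (f : ℕ → ℤ → R) (A : Finset ℤ) (b : ℤ) (N : ℕ) (M : ℤ → ℤ) (c : ℤ)
    (hc : M c < 0) : HH f A b N M = 0 := by
  induction N generalizing M with
  | zero => simp [HH]
  | succ N ih =>
    rw [HH, ih M hc, GG_neg f A N M c hc, mul_zero, zero_add, zero_add]
    refine Finset.sum_eq_zero fun a _ => ?_
    rw [ih, mul_zero]
    have := eZ_nonneg a c
    simp only [Pi.sub_apply]; linarith

theorem GG_eq_HH (f : ℕ → ℤ → R) (A : Finset ℤ) (b : ℤ) (hb : b ∈ A) (N : ℕ) (M : ℤ → ℤ)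
    (hM : M b = 0) : GG f A N (M + eZ b) = HH f A b N M := by
  induction N generalizing M with
  | zero =>
    have : M + eZ b ≠ 0 := by
      intro h
      have := congrFun h b
      simp [hM, eZ] at this
    simp [GG, HH, this]
  | succ N ih =>
    rw [GG, HH, ih M hM, add_assoc, ← Finset.add_sum_erase A _ hb, ← Finset.add_sum_erase A _ hb,
      add_sub_cancel_right, HH_neg f A b N (M - eZ b) b (by simp [hM, eZ]), mul_zero, zero_add]
    congr 2
    refine Finset.sum_congr rfl fun a ha => ?_
    rw [← ih (M - eZ a), sub_add_eq_add_sub]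
    have : b ≠ a := (Finset.ne_of_mem_erase ha).symm
    simp [hM, eZ, this]

theorem sum_sq_char_two [CharP R 2] (A : Finset ℤ) (g : ℤ → ℤ → R) (hg : ∀ a b, g a b = g b a) :
    ∑ a ∈ A, ∑ b ∈ A, g a b = ∑ a ∈ A, g a a := by
  induction A using Finset.induction_on with
  | empty => simp
  | insert x A hx ih =>
    rw [Finset.sum_insert hx, Finset.sum_insert hx, Finset.sum_insert hx]
    simp only [Finset.sum_insert hx, Finset.sum_add_distrib]
    rw [ih, Finset.sum_congr rfl fun a _ => hg a x]
    have := CharTwo.add_self_eq_zero (∑ a ∈ A, g x a)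
    linear_combination this

theorem main_identity [CharP R 2] (f : ℕ → ℤ → R) (hf : ∀ d a, f d (2 * a) = f d a ^ 2)
    (A : Finset ℤ) (φ : (ℤ → ℤ) → R) (hφ0 : φ 0 = 0)
    (hφ : ∀ M, ∀ a ∈ A, φ (M - eZ a) = φ M - 1) (N : ℕ) (M : ℤ → ℤ) :
    φ M * GG f A N M + ∑ a ∈ A, HH f A (2 * a) N (M - eZ a - eZ a) =
      ∑ a ∈ A, (∑ d ∈ Finset.range N, f d a) * GG f A N (M - eZ a) := by
  induction N generalizing M with
  | zero =>
    by_cases h : M = 0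
    · simp [GG, HH, h, hφ0]
    · simp [GG, HH, h]
  | succ N ih =>
    have h1 := ih M
    have h2 : ∑ c ∈ A, f N c * ((φ M - 1) * GG f A N (M - eZ c)
          + ∑ a ∈ A, HH f A (2 * a) N (M - eZ c - eZ a - eZ a)) =
        ∑ c ∈ A, f N c * ∑ a ∈ A, (∑ d ∈ Finset.range N, f d a) * GG f A N (M - eZ c - eZ a) := by
      refine Finset.sum_congr rfl fun c hc => ?_
      rw [← ih (M - eZ c), hφ M c hc]
    have h3 := sum_sq_char_two A (fun a c => f N a * f N c * GG f A N (M - eZ a - eZ c))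
      (fun a c => by rw [sub_right_comm, mul_comm (f N a)])
    simp only [GG, HH, Finset.sum_range_succ, add_mul, mul_add, Finset.sum_add_distrib] at h2 ⊢
    have e1 : ∑ a ∈ A, ∑ c ∈ A, f N c * HH f A (2 * a) N (M - eZ a - eZ a - eZ c)
        = ∑ c ∈ A, f N c * ∑ a ∈ A, HH f A (2 * a) N (M - eZ c - eZ a - eZ a) := by
      rw [Finset.sum_comm]
      refine Finset.sum_congr rfl fun c _ => ?_
      rw [Finset.mul_sum]
      refine Finset.sum_congr rfl fun a _ => ?_
      rw [sub_right_comm (M - eZ a), sub_right_comm M]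
    have e2 : ∑ a ∈ A, (∑ d ∈ Finset.range N, f d a) * ∑ c ∈ A, f N c * GG f A N (M - eZ a - eZ c)
        = ∑ c ∈ A, f N c * ∑ a ∈ A, (∑ d ∈ Finset.range N, f d a) * GG f A N (M - eZ c - eZ a) := by
      simp only [Finset.mul_sum]
      rw [Finset.sum_comm]
      refine Finset.sum_congr rfl fun c _ => Finset.sum_congr rfl fun a _ => ?_
      rw [sub_right_comm M]; ring
    have e3 : ∑ a ∈ A, f N (2 * a) * GG f A N (M - eZ a - eZ a)
        = ∑ a ∈ A, f N a * ∑ c ∈ A, f N c * GG f A N (M - eZ a - eZ c) := by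
      simp only [Finset.mul_sum, ← mul_assoc]
      rw [h3]
      refine Finset.sum_congr rfl fun c _ => ?_
      rw [hf, sq]
    have e4 : ∑ c ∈ A, f N c * ((φ M - 1) * GG f A N (M - eZ c)) =
        φ M * ∑ c ∈ A, f N c * GG f A N (M - eZ c) - ∑ c ∈ A, f N c * GG f A N (M - eZ c) := by
      rw [Finset.mul_sum, ← Finset.sum_sub_distrib]
      refine Finset.sum_congr rfl fun c _ => ?_
      ring
    rw [e1, e2, e3]
    rw [e4] at h2
    linear_combination h1 + h2

def TT (f : ℕ → ℤ → R) : ℕ → List ℤ → R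
  | _, [] => 1
  | 0, _ :: _ => 0
  | N + 1, a :: w => TT f N (a :: w) + f N a * TT f N w

def PP (u : List ℤ) : Finset (List ℤ) := u.permutations.toFinset

theorem mem_PP (u w : List ℤ) : w ∈ PP u ↔ w.Perm u := by simp [PP]

def hdT (f : ℕ → ℤ → R) (N : ℕ) : List ℤ → R
  | [] => 0
  | a :: w => f N a * TT f N w

theorem TT_succ (f : ℕ → ℤ → R) (N : ℕ) (w : List ℤ) :
    TT f (N + 1) w = TT f N w + hdT f N w := by
  cases w <;> cases N <;> simp [TT, hdT]

theorem sum_hdT (f : ℕ → ℤ → R) (N : ℕ) (u : List ℤ) :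
    ∑ w ∈ PP u, hdT f N w = ∑ a ∈ u.toFinset, f N a * ∑ w ∈ PP (u.erase a), TT f N w := by
  have : ∀ a ∈ u.toFinset, f N a * ∑ w ∈ PP (u.erase a), TT f N w =
      ∑ w ∈ (PP (u.erase a)).image (fun w => a :: w), hdT f N w := by
    intro a _
    rw [Finset.sum_image (by intro x _ y _ h; simpa using h), Finset.mul_sum]
    rfl
  rw [Finset.sum_congr rfl this, ← Finset.sum_biUnion]
  · symm
    apply Finset.sum_subset
    · intro w hw
      simp only [Finset.mem_biUnion, Finset.mem_image, mem_PP, List.mem_toFinset] at hw ⊢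
      obtain ⟨a, ha, w, hw, rfl⟩ := hw
      exact (hw.cons a).trans (List.perm_cons_erase ha).symm
    · intro w hw hw'
      simp only [Finset.mem_biUnion, Finset.mem_image, mem_PP, List.mem_toFinset] at hw hw'
      cases w with
      | nil => rfl
      | cons a w =>
        exfalso
        have ha : a ∈ u := hw.subset (by simp)
        refine hw' ⟨a, ha, w, ?_, rfl⟩
        exact List.Perm.cons_inv (hw.trans (List.perm_cons_erase ha))
  · intro a _ b _ hab
    simp only [Function.onFun]
    rw [Finset.disjoint_left]
    intro w hw hw'
    simp only [Finset.mem_image] at hw hw'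
    obtain ⟨x, _, rfl⟩ := hw
    obtain ⟨y, _, h⟩ := hw'
    simp at h
    exact hab h.1.symm

def cnt (u : List ℤ) : ℤ → ℤ := fun a => (u.count a : ℤ)

theorem cnt_erase (u : List ℤ) (a : ℤ) (ha : a ∈ u) : cnt u - eZ a = cnt (u.erase a) := by
  funext c
  simp only [cnt, eZ, Pi.sub_apply, List.count_erase]
  by_cases h : c = a
  · subst h
    have : 0 < u.count c := List.count_pos_iff.2 ha
    simp; omega
  · simp [h, Ne.symm h]

theorem sum_TT (f : ℕ → ℤ → R) (A : Finset ℤ) (N : ℕ) (u : List ℤ) (hu : ∀ a ∈ u, a ∈ A) :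
    ∑ w ∈ PP u, TT f N w = GG f A N (cnt u) := by
  induction N generalizing u with
  | zero =>
    cases u with
    | nil =>
      have : cnt [] = 0 := by funext c; simp [cnt]
      simp [GG, this, PP, TT]
    | cons a u =>
      have : cnt (a :: u) ≠ 0 := by
        intro h
        have := congrFun h a
        simp [cnt] at this
        omega
      simp only [GG, this, if_false]
      refine Finset.sum_eq_zero fun w hw => ?_
      rw [mem_PP] at hw
      cases w with
      | nil => simp at hw
      | cons b w => simp [TT]
  | succ N ih =>
    simp only [TT_succ, Finset.sum_add_distrib, GG, sum_hdT]
    rw [ih u hu]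
    congr 1
    have hsub : u.toFinset ⊆ A := fun a ha => hu a (by simpa using ha)
    rw [← Finset.sum_subset hsub]
    · refine Finset.sum_congr rfl fun a ha => ?_
      rw [cnt_erase u a (by simpa using ha), ih]
      intro b hb
      exact hu b (List.mem_of_mem_erase hb)
    · intro a _ ha
      rw [GG_neg f A N _ a, mul_zero]
      have : u.count a = 0 := List.count_eq_zero.2 (by simpa using ha)
      simp [cnt, eZ, this]

/-- finite truncation of the sum -/
def BB (N l : ℕ) : Finset (Fin l → ℕ) :=
  (Fintype.piFinset fun _ => Finset.range N).filter StrictAnti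

theorem mem_BB (N l : ℕ) (d : Fin l → ℕ) : d ∈ BB N l ↔ (∀ i, d i < N) ∧ StrictAnti d := by
  simp [BB]

theorem strictAnti_cons {l : ℕ} (N : ℕ) (d : Fin l → ℕ) (h : StrictAnti (Fin.cons N d : Fin (l+1) → ℕ)) :
    (∀ i, d i < N) ∧ StrictAnti d := by
  constructor
  · intro i
    have := h (Fin.succ_pos i)
    simpa using this
  · intro i j hij
    have := h (Fin.succ_lt_succ_iff.2 hij)
    simpa using this

theorem strictAnti_cons' {l : ℕ} (N : ℕ) (d : Fin l → ℕ) (h : ∀ i, d i < N) (h' : StrictAnti d) :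
    StrictAnti (Fin.cons N d : Fin (l+1) → ℕ) := by
  intro i j hij
  induction i using Fin.cases with
  | zero =>
    induction j using Fin.cases with
    | zero => simp at hij
    | succ j => simpa using h j
  | succ i =>
    induction j using Fin.cases with
    | zero => simp at hij
    | succ j => simpa using h' (Fin.succ_lt_succ_iff.1 hij)

theorem TT_eq (f : ℕ → ℤ → R) (N : ℕ) (w : List ℤ) :
    TT f N w = ∑ d ∈ BB N w.length, ∏ i, f (d i) (w.get i) := by
  induction N generalizing w with
  | zero =>
    cases w with
    | nil =>
      have : BB 0 ([] : List ℤ).length = {Fin.elim0} := by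
        ext d
        rw [mem_BB]
        simp only [List.length_nil, IsEmpty.forall_iff, true_and, Finset.mem_singleton]
        refine ⟨fun _ => Subsingleton.elim _ _, fun _ i => i.elim0⟩
      rw [this]; simp [TT]
    | cons a w =>
      have : BB 0 (a :: w).length = ∅ := by
        ext d
        rw [mem_BB]
        simp
      rw [this]; simp [TT]
  | succ N ih =>
    cases w with
    | nil =>
      have : BB (N + 1) ([] : List ℤ).length = {Fin.elim0} := by
        ext d
        rw [mem_BB]
        simp only [List.length_nil, IsEmpty.forall_iff, true_and, Finset.mem_singleton]
        refine ⟨fun _ => Subsingleton.elim _ _, fun _ i => i.elim0⟩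
      rw [this]; simp [TT]
    | cons a w =>
      rw [TT, ih, ih]
      have hsplit : BB (N + 1) (w.length + 1) = BB N (w.length + 1) ∪
          (BB N w.length).image (fun d => (Fin.cons N d : Fin (w.length + 1) → ℕ)) := by
        ext d
        simp only [Finset.mem_union, Finset.mem_image, mem_BB]
        constructor
        · rintro ⟨h1, h2⟩
          by_cases h : d 0 = N
          · right
            have hd : (Fin.cons N (Fin.tail d) : Fin (w.length + 1) → ℕ) = d := by
              rw [← h]; exact Fin.cons_self_tail d
            refine ⟨Fin.tail d, ?_, hd⟩
            rw [← hd] at h2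
            exact strictAnti_cons N _ h2
          · left
            refine ⟨fun i => ?_, h2⟩
            have h3 := h2.antitone (Fin.zero_le i)
            have h4 := h1 0
            omega
        · rintro (⟨h1, h2⟩ | ⟨d, ⟨h1, h2⟩, rfl⟩)
          · exact ⟨fun i => (h1 i).trans (Nat.lt_succ_self N), h2⟩
          · refine ⟨fun i => ?_, strictAnti_cons' N d h1 h2⟩
            induction i using Fin.cases with
            | zero => simp
            | succ i => simpa using (h1 i).trans (Nat.lt_succ_self N)
      have hdisj : Disjoint (BB N (w.length + 1))
          ((BB N w.length).image (fun d => (Fin.cons N d : Fin (w.length + 1) → ℕ))) := by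
        rw [Finset.disjoint_left]
        intro d hd hd'
        simp only [Finset.mem_image] at hd'
        obtain ⟨e, _, rfl⟩ := hd'
        have := ((mem_BB _ _ _).1 hd).1 0
        simp at this
      simp only [List.length_cons]
      rw [hsplit, Finset.sum_union hdisj, Finset.sum_image (by
        intro x _ y _ h
        exact (Fin.cons_injective2 h).2)]
      congr 1
      rw [Finset.mul_sum]
      refine Finset.sum_congr rfl fun d _ => ?_
      rw [Fin.prod_univ_succ]
      simp

end Comb

section Val
open Polynomial

theorem val_pow_sub {K Γ : Type*} [Field K] [LinearOrderedCommGroupWithZero Γ] (ν : Valuation K Γ)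
    (x y : K) (hx : ν x = 1) (hy : ν y = 1) (e : Γ) (h : ν (x - y) ≤ e) (n : ℕ) :
    ν (x ^ n - y ^ n) ≤ e := by
  induction n with
  | zero => simp
  | succ n ih =>
    have : x ^ (n + 1) - y ^ (n + 1) = x * (x ^ n - y ^ n) + (x - y) * y ^ n := by ring
    rw [this]
    refine ν.map_add_le ?_ ?_
    · rw [map_mul, hx, one_mul]; exact ih
    · rw [map_mul, map_pow, hy, one_pow, mul_one]; exact h

theorem val_zpow_sub {K Γ : Type*} [Field K] [LinearOrderedCommGroupWithZero Γ] (ν : Valuation K Γ)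
    (x y : K) (hx : ν x = 1) (hy : ν y = 1) (e : Γ) (h : ν (x - y) ≤ e) (n : ℤ) :
    ν (x ^ n - y ^ n) ≤ e := by
  obtain ⟨n, rfl | rfl⟩ := n.eq_nat_or_neg
  · simpa using val_pow_sub ν x y hx hy e h n
  · have hx0 : x ≠ 0 := by rintro rfl; simp at hx
    have hy0 : y ≠ 0 := by rintro rfl; simp at hy
    have : x ^ (-(n : ℤ)) - y ^ (-(n : ℤ)) = -((x ^ n - y ^ n) * (x ^ n)⁻¹ * (y ^ n)⁻¹) := by
      simp only [zpow_neg, zpow_natCast]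
      field_simp
      ring
    rw [this, Valuation.map_neg, map_mul, map_mul, map_inv₀, map_inv₀, map_pow, map_pow, hx, hy]
    simpa using val_pow_sub ν x y hx hy e h n

variable {F : Type*} [Field F]

theorem finite_degLT [Finite F] (N : ℕ) : {a : F[X] | a.degree < N}.Finite := by
  have : Finite (degreeLT F N) := Finite.of_equiv _ (degreeLTEquiv F N).symm.toEquiv
  have h : (({a : F[X] | a.degree < N}) : Set F[X]) = (degreeLT F N : Set F[X]) := by
    ext a; simp [mem_degreeLT]
  rw [h]
  exact Set.toFinite _

/-- polynomials of degree less than N prime to v -/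
def DD [Finite F] (v : F[X]) (N : ℕ) : Finset F[X] :=
  (finite_degLT (F := F) N).toFinset.filter fun a => ¬ v ∣ a

theorem mem_DD [Finite F] (v : F[X]) (N : ℕ) (a : F[X]) :
    a ∈ DD v N ↔ a.degree < N ∧ ¬ v ∣ a := by simp [DD]

def MM [Finite F] (v : F[X]) (d : ℕ) : Finset F[X] :=
  (DD v (d + 1)).filter fun a => a.Monic ∧ a.natDegree = d

theorem mem_MM [Finite F] (v : F[X]) (d : ℕ) (a : F[X]) :
    a ∈ MM v d ↔ a.Monic ∧ a.natDegree = d ∧ ¬ v ∣ a := by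
  simp only [MM, Finset.mem_filter, mem_DD]
  constructor
  · tauto
  · rintro ⟨h1, h2, h3⟩
    refine ⟨⟨?_, h3⟩, h1, h2⟩
    rw [degree_eq_natDegree h1.ne_zero, h2]
    exact_mod_cast Nat.lt_succ_self d

theorem Stilde_eq [Finite F] (v : F[X]) (d : ℕ) (k : ℤ) :
    Stilde v d k = ∑ a ∈ MM v d, (algebraMap F[X] (RatFunc F) a) ^ (-k) := by
  have h : {a : F[X] | a.Monic ∧ a.natDegree = d ∧ ¬ v ∣ a} = (MM v d : Set F[X]) := by
    ext a; simp [mem_MM]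
  rw [Stilde, h, finsum_mem_coe_finset]

theorem Stilde_sq [Finite F] [CharP (RatFunc F) 2] (v : F[X]) (d : ℕ) (k : ℤ) :
    Stilde v d (2 * k) = Stilde v d k ^ 2 := by
  have : Fact (Nat.Prime 2) := ⟨Nat.prime_two⟩
  rw [Stilde_eq, Stilde_eq, sum_pow_char 2]
  refine Finset.sum_congr rfl fun a _ => ?_
  rw [← zpow_natCast, ← zpow_mul]
  congr 1
  push_cast; ring

theorem val_one (v : F[X]) (hv : Irreducible v) (a : F[X]) (ha : ¬ v ∣ a) :
    (heightOneOf v hv).valuation (RatFunc F) (algebraMap F[X] (RatFunc F) a) = 1 := by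
  rw [IsDedekindDomain.HeightOneSpectrum.valuation_eq_one_iff_notMem]
  simpa [heightOneOf, Ideal.mem_span_singleton] using ha

theorem val_vpow (v : F[X]) (hv : Irreducible v) (m : ℕ) :
    (heightOneOf v hv).valuation (RatFunc F) (algebraMap F[X] (RatFunc F) (v ^ m))
      ≤ WithZero.exp (-(m : ℤ)) := by
  rw [IsDedekindDomain.HeightOneSpectrum.valuation_of_algebraMap,
    IsDedekindDomain.HeightOneSpectrum.intValuation_le_pow_iff_mem]
  apply Ideal.pow_mem_pow
  simp [heightOneOf, Ideal.mem_span_singleton]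

theorem val_Stilde [Finite F] (v : F[X]) (hv : Irreducible v) (d : ℕ) (k : ℤ) :
    (heightOneOf v hv).valuation (RatFunc F) (Stilde v d k) ≤ 1 := by
  rw [Stilde_eq]
  refine Valuation.map_sum_le _ fun a ha => ?_
  rw [map_zpow₀, val_one v hv a ((mem_MM _ _ _).1 ha).2.2, one_zpow]

theorem val_sum_DD [Finite F] [CharP F 2] [CharP (RatFunc F) 2] (v : F[X]) (hv : Irreducible v)
    (N m : ℕ) (hm : 1 ≤ m) (hN : m * v.natDegree < N) (k : ℤ) :
    (heightOneOf v hv).valuation (RatFunc F)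
      (∑ a ∈ DD v N, (algebraMap F[X] (RatFunc F) a) ^ k) ≤ WithZero.exp (-(m : ℤ)) := by
  set ν := (heightOneOf v hv).valuation (RatFunc F)
  let I : AddSubgroup (RatFunc F) :=
    { carrier := {x | ν x ≤ WithZero.exp (-(m : ℤ))}
      zero_mem' := by simp
      add_mem' := fun {x y} hx hy => ν.map_add_le hx hy
      neg_mem' := fun {x} hx => by simpa [Valuation.map_neg] using hx }
  change _ ∈ I
  rw [← QuotientAddGroup.eq_zero_iff]
  have hmk : ((∑ a ∈ DD v N, (algebraMap F[X] (RatFunc F) a) ^ k : RatFunc F) : RatFunc F ⧸ I)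
      = ∑ a ∈ DD v N, (((algebraMap F[X] (RatFunc F) a) ^ k : RatFunc F) : RatFunc F ⧸ I) :=
    map_sum (QuotientAddGroup.mk' I) _ _
  rw [hmk]
  have hnd : ∀ a : F[X], ¬ v ∣ a → ¬ v ∣ a + v ^ m := by
    intro a ha h
    exact ha ((dvd_add_left (dvd_pow_self v (by omega))).1 h)
  refine Finset.sum_involution (fun a _ => a + v ^ m) ?_ ?_ ?_ ?_
  · intro a ha
    have ha := ((mem_DD _ _ _).1 ha).2
    rw [← QuotientAddGroup.mk_add, QuotientAddGroup.eq_zero_iff]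
    have := val_zpow_sub ν (algebraMap F[X] (RatFunc F) a)
      (algebraMap F[X] (RatFunc F) (a + v ^ m)) (val_one v hv a ha)
      (val_one v hv _ (hnd a ha)) (WithZero.exp (-(m : ℤ))) (by
        rw [map_add, sub_add_cancel_left, Valuation.map_neg]
        exact val_vpow v hv m) k
    rw [CharTwo.sub_eq_add] at this
    exact this
  · intro a ha _ h
    exact pow_ne_zero m hv.ne_zero (by simpa using h)
  · intro a ha
    rw [mem_DD] at ha ⊢
    refine ⟨(degree_add_le _ _).trans_lt (max_lt ha.1 ?_), hnd a ha.2⟩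
    rw [degree_eq_natDegree (pow_ne_zero m hv.ne_zero), natDegree_pow]
    exact_mod_cast hN
  · intro a ha
    rw [add_assoc, CharTwo.add_self_eq_zero, add_zero]

theorem sum_DD_eq [Fintype F] [CharP (RatFunc F) 2] (v : F[X]) (hv : Irreducible v)
    (hq : ∃ m : ℕ, Fintype.card F = 2 ^ m) (N : ℕ) (k : ℤ)
    (hk : ((Fintype.card F : ℤ) - 1) ∣ k) :
    ∑ d ∈ Finset.range N, Stilde v d k =
      ∑ a ∈ DD v N, (algebraMap F[X] (RatFunc F) a) ^ (-k) := by
  have h1 : ∀ c : Fˣ, (algebraMap F[X] (RatFunc F) (C (c : F))) ^ (-k) = 1 := by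
    intro c
    obtain ⟨j, rfl⟩ := hk
    have hc : (c : F) ^ (Fintype.card F - 1) = 1 := FiniteField.pow_card_sub_one_eq_one _ c.ne_zero
    have hcard : 1 ≤ Fintype.card F := Fintype.card_pos
    have e : -(((Fintype.card F : ℤ) - 1) * j) = ((Fintype.card F - 1 : ℕ) : ℤ) * (-j) := by
      push_cast [hcard]; ring
    rw [e, zpow_mul, zpow_natCast, ← map_pow, ← C_pow, hc]
    simp
  have hodd : ((Fintype.card Fˣ : ℕ) : RatFunc F) = 1 := by
    rw [Fintype.card_units]
    obtain ⟨m, hm⟩ := hq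
    have hm0 : m ≠ 0 := by
      rintro rfl
      have := Fintype.one_lt_card (α := F)
      omega
    have : ((Fintype.card F - 1 : ℕ) : RatFunc F) + 1 = 0 := by
      have h2 : ((2 : ℕ) : RatFunc F) = 0 := CharP.cast_eq_zero _ 2
      have h3 : Fintype.card F - 1 + 1 = Fintype.card F := Nat.sub_add_cancel Fintype.card_pos
      have : ((Fintype.card F : ℕ) : RatFunc F) = 0 := by
        rw [hm, Nat.cast_pow, h2, zero_pow hm0]
      rw [← this, ← h3]; push_cast; simp
    rw [← CharTwo.sub_eq_add] at this
    exact sub_eq_zero.1 this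
  calc ∑ d ∈ Finset.range N, Stilde v d k
      = ∑ d ∈ Finset.range N, ∑ c : Fˣ, ∑ a ∈ MM v d,
          (algebraMap F[X] (RatFunc F) (C (c : F) * a)) ^ (-k) := by
        refine Finset.sum_congr rfl fun d _ => ?_
        simp only [map_mul, mul_zpow, h1, one_mul]
        rw [Finset.sum_const, Finset.card_univ, nsmul_eq_mul, hodd, one_mul, Stilde_eq]
    _ = ∑ p ∈ (Finset.range N).sigma (fun d => (Finset.univ : Finset Fˣ) ×ˢ MM v d),
          (algebraMap F[X] (RatFunc F) (C (p.2.1 : F) * p.2.2)) ^ (-k) := by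
        rw [Finset.sum_sigma]
        refine Finset.sum_congr rfl fun d _ => ?_
        rw [Finset.sum_product]
    _ = _ := by
        refine Finset.sum_bij (fun p _ => C (p.2.1 : F) * p.2.2) ?_ ?_ ?_ ?_
        · rintro ⟨d, c, a⟩ hp
          simp only [Finset.mem_sigma, Finset.mem_range, Finset.mem_product, Finset.mem_univ,
            true_and, mem_MM] at hp
          obtain ⟨hd, ha, hda, hva⟩ := hp
          rw [mem_DD]
          constructor
          · rw [degree_C_mul c.ne_zero, degree_eq_natDegree ha.ne_zero, hda]
            exact_mod_cast hd
          · intro h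
            apply hva
            have : IsUnit (C (c : F)) := isUnit_C.2 c.isUnit
            exact (this.dvd_mul_left).1 h
        · rintro ⟨d, c, a⟩ hp ⟨d', c', a'⟩ hp' h
          simp only [Finset.mem_sigma, Finset.mem_range, Finset.mem_product, Finset.mem_univ,
            true_and, mem_MM] at hp hp' h
          obtain ⟨hd, ha, hda, hva⟩ := hp
          obtain ⟨hd', ha', hda', hva'⟩ := hp'
          have hc : c = c' := by
            have := congrArg leadingCoeff h
            simp [ha.leadingCoeff, ha'.leadingCoeff] at this
            exact Units.ext this
          subst hc
          have haa : a = a' := mul_left_cancel₀ (by simp) h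
          subst haa
          have : d = d' := by rw [← hda, hda']
          subst this
          rfl
        · intro b hb
          rw [mem_DD] at hb
          have hb0 : b ≠ 0 := by rintro rfl; exact hb.2 (dvd_zero _)
          have hl : b.leadingCoeff ≠ 0 := leadingCoeff_ne_zero.2 hb0
          refine ⟨⟨b.natDegree, Units.mk0 b.leadingCoeff hl, C (b.leadingCoeff⁻¹) * b⟩, ?_, ?_⟩
          · simp only [Finset.mem_sigma, Finset.mem_range, Finset.mem_product, Finset.mem_univ,
              true_and, mem_MM]
            refine ⟨?_, ?_, ?_, ?_⟩
            · rw [degree_eq_natDegree hb0] at hb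
              exact_mod_cast hb.1
            · rw [Monic, leadingCoeff_mul, leadingCoeff_C, inv_mul_cancel₀ hl]
            · rw [natDegree_C_mul (inv_ne_zero hl)]
            · intro h
              apply hb.2
              have : IsUnit (C (b.leadingCoeff⁻¹)) := isUnit_C.2 (inv_ne_zero hl).isUnit
              exact (this.dvd_mul_left).1 h
          · simp only [Units.val_mk0]
            rw [← mul_assoc, ← C_mul, mul_inv_cancel₀ hl, C_1, one_mul]
        · intro _ _; rfl

theorem val_GG [Finite F] (v : F[X]) (hv : Irreducible v) (A : Finset ℤ) (N : ℕ) (M : ℤ → ℤ) :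
    (heightOneOf v hv).valuation (RatFunc F) (GG (Stilde v) A N M) ≤ 1 := by
  induction N generalizing M with
  | zero =>
    rw [GG]; split_ifs <;> simp
  | succ N ih =>
    rw [GG]
    refine Valuation.map_add_le _ (ih M) (Valuation.map_sum_le _ fun a _ => ?_)
    rw [map_mul]
    exact mul_le_one' (val_Stilde v hv N a) (ih _)

instance instKvTop (v : F[X]) (hv : Irreducible v) : IsTopologicalRing (Kv v hv) :=
  inferInstanceAs (IsTopologicalRing ((heightOneOf v hv).adicCompletion (RatFunc F)))

instance instKvT2 (v : F[X]) (hv : Irreducible v) : T2Space (Kv v hv) :=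
  inferInstanceAs (T2Space ((heightOneOf v hv).adicCompletion (RatFunc F)))

theorem tendsto_zero_of_val (v : F[X]) (hv : Irreducible v) (x : ℕ → RatFunc F)
    (h : ∀ m : ℕ, 1 ≤ m → ∀ᶠ N in Filter.atTop,
      (heightOneOf v hv).valuation (RatFunc F) (x N) ≤ WithZero.exp (-(m : ℤ))) :
    Filter.Tendsto (fun N => algebraMap (RatFunc F) (Kv v hv) (x N)) Filter.atTop (nhds 0) := by
  change Filter.Tendsto (fun N => algebraMap (RatFunc F)
    ((heightOneOf v hv).adicCompletion (RatFunc F)) (x N)) Filter.atTop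
    (nhds (0 : (heightOneOf v hv).adicCompletion (RatFunc F)))
  rw [(Valued.hasBasis_nhds_zero ((heightOneOf v hv).adicCompletion (RatFunc F))
    (WithZero (Multiplicative ℤ))).tendsto_right_iff]
  intro γ _
  simp only [Set.mem_ofPred_eq, Valuation.restrict_lt_iff_lt_embedding]
  set g := MonoidWithZeroHom.ValueGroup₀.embedding γ.1 with hg
  have hg0 : g ≠ 0 := by
    rw [hg]; simp
  obtain ⟨z, hz⟩ : ∃ z : ℤ, g = WithZero.exp z := ⟨WithZero.log g, (WithZero.exp_log hg0).symm⟩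
  filter_upwards [h (z.natAbs + 1) (by omega)] with N hN
  have hval : Valued.v (algebraMap (RatFunc F)
      ((heightOneOf v hv).adicCompletion (RatFunc F)) (x N)) =
      (heightOneOf v hv).valuation (RatFunc F) (x N) := by
    rw [IsDedekindDomain.HeightOneSpectrum.algebraMap_adicCompletion]
    simp
  rw [hval, hz]
  refine hN.trans_lt ?_
  rw [WithZero.exp_lt_exp]
  have := neg_abs_le z
  push_cast
  linarith

theorem tendsto_TT (v : F[X]) (hv : Irreducible v) (w : List ℤ)
    (h : Summable (zetavTerm v hv w)) :
    Filter.Tendsto (fun N => algebraMap (RatFunc F) (Kv v hv) (TT (Stilde v) N w)) Filter.atTop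
      (nhds (zetav v hv w)) := by
  have h1 : HasSum (zetavTerm v hv w) (zetav v hv w) := h.hasSum
  let S : ℕ → Finset {d : Fin w.length → ℕ // StrictAnti d} := fun N =>
    (BB N w.length).subtype StrictAnti
  have hS : Filter.Tendsto S Filter.atTop Filter.atTop := by
    refine Filter.tendsto_atTop_finset_of_monotone ?_ ?_
    · intro N N' hN d hd
      simp only [S, Finset.mem_subtype, mem_BB] at hd ⊢
      exact ⟨fun i => (hd.1 i).trans_le hN, hd.2⟩
    · intro d
      refine ⟨∑ i, d.1 i + 1, ?_⟩
      simp only [S, Finset.mem_subtype, mem_BB]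
      exact ⟨fun i => Nat.lt_succ_of_le (Finset.single_le_sum (f := d.1) (fun _ _ => Nat.zero_le _)
        (Finset.mem_univ i)), d.2⟩
  have h2 := Filter.Tendsto.comp h1 hS
  refine h2.congr fun N => ?_
  simp only [Function.comp, S, zetavTerm]
  rw [TT_eq, ← map_sum]
  congr 1
  refine Finset.sum_subtype_of_mem (fun d : Fin w.length → ℕ => ∏ i, Stilde v (d i) (w.get i)) ?_
  intro d hd
  exact ((mem_BB _ _ _).1 hd).2

theorem Lsum_eq {β : Type*} [AddCommMonoid β] (g : List ℤ → β) (u : List ℤ) :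
    Lsum g u = ∑ w ∈ PP u, g w := by
  have h : {w : List ℤ | w.Perm u} = (PP u : Set (List ℤ)) := by
    ext w; simp [mem_PP]
  rw [Lsum, h, finsum_mem_coe_finset]

theorem tendsto_Lsum (v : F[X]) (hv : Irreducible v) (A : Finset ℤ) (u : List ℤ)
    (hu : ∀ a ∈ u, a ∈ A)
    (h : ∀ w : List ℤ, w.Perm u → Summable (zetavTerm v hv w)) :
    Filter.Tendsto (fun N => algebraMap (RatFunc F) (Kv v hv) (GG (Stilde v) A N (cnt u)))
      Filter.atTop (nhds (Lsum (zetav v hv) u)) := by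
  rw [Lsum_eq]
  simp only [← sum_TT (Stilde v) A _ u hu, map_sum]
  refine tendsto_finsetSum _ fun w hw => tendsto_TT v hv w (h w ((mem_PP _ _).1 hw))

theorem cnt_mkTuple {n : ℕ} (s : Fin n → ℤ) (c : Fin n → ℕ) :
    cnt (mkTuple s c) = ∑ i, (c i : ℤ) • eZ (s i) := by
  funext a
  simp only [cnt, mkTuple, List.count_flatMap, Finset.sum_apply, Pi.smul_apply, smul_eq_mul]
  rw [← List.sum_ofFn, List.ofFn_eq_map, Nat.cast_list_sum, List.map_map]
  congr 1
  refine List.map_congr_left fun i _ => ?_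
  simp only [Function.comp, List.count_replicate, eZ]
  by_cases h : a = s i
  · subst h; simp
  · simp [h, Ne.symm h]

theorem mem_mkTuple {n : ℕ} (s : Fin n → ℤ) (c : Fin n → ℕ) (a : ℤ) (h : a ∈ mkTuple s c) :
    ∃ i, a = s i := by
  simp only [mkTuple, List.mem_flatMap, List.mem_replicate] at h
  obtain ⟨i, _, _, h⟩ := h
  exact ⟨i, h⟩

theorem main_aux [Fintype F] (q : ℕ) (hq : Fintype.card F = q)
    (hq2 : ∃ m : ℕ, q = 2 ^ m)
    (v : F[X]) (hv : Irreducible v)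
    (n : ℕ) (s : Fin n → ℤ) (k : Fin n → ℕ)
    (hinj : Function.Injective s)
    (hd2 : ∀ i j, 1 < k i → 2 * s i ≠ s j)
    (heven : ∀ i, ((q : ℤ) - 1) ∣ s i)
    (hsum : ∀ w : List ℤ,
      (List.Perm w (mkTuple s k) ∨
        ∃ i, 1 < k i ∧
          List.Perm w (2 * s i :: mkTuple s (Function.update k i (k i - 2)))) →
      Summable (zetavTerm v hv w)) :
    (∑ i ∈ Finset.univ.filter fun i => 1 < k i,
        Lsum (zetav v hv) (2 * s i :: mkTuple s (Function.update k i (k i - 2))))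
      + (∑ i, k i) • Lsum (zetav v hv) (mkTuple s k) = 0 := by
  subst hq
  have hchar : CharP F 2 := by
    obtain ⟨m, hm⟩ := hq2
    obtain ⟨p, hp⟩ := CharP.exists F
    obtain ⟨r, hpp, hr⟩ := FiniteField.card F p
    have h2 : p = 2 := by
      have : p ∣ 2 ^ m := by
        rw [← hm, hr]; exact dvd_pow_self p r.pos.ne'
      exact (Nat.prime_dvd_prime_iff_eq hpp Nat.prime_two).1 (hpp.dvd_of_dvd_pow this)
    subst h2
    exact hp
  have hcharR : CharP (RatFunc F) 2 := charP_of_injective_algebraMap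
    (FaithfulSMul.algebraMap_injective F (RatFunc F)) 2
  set A : Finset ℤ := Finset.univ.image s ∪ Finset.univ.image (fun i => 2 * s i) with hA
  have hsA : ∀ i, s i ∈ A := fun i => by simp [hA]
  have hs2A : ∀ i, 2 * s i ∈ A := fun i => by simp [hA]
  have hAeven : ∀ a ∈ A, ((Fintype.card F : ℤ) - 1) ∣ a := by
    intro a ha
    simp only [hA, Finset.mem_union, Finset.mem_image, Finset.mem_univ, true_and] at ha
    obtain ⟨i, rfl⟩ | ⟨i, rfl⟩ := ha
    · exact heven i
    · exact (heven i).mul_left 2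
  set M := cnt (mkTuple s k) with hM
  have hMs : ∀ i, M (s i) = k i := by
    intro i
    rw [hM, cnt_mkTuple]
    simp only [Finset.sum_apply, Pi.smul_apply, smul_eq_mul, eZ]
    rw [Finset.sum_eq_single i]
    · simp
    · intro j _ hj
      have : s i ≠ s j := fun h => hj (hinj h).symm
      simp [this]
    · simp
  have hM0 : ∀ a, (∀ i, a ≠ s i) → M a = 0 := by
    intro a ha
    have : (mkTuple s k).count a = 0 := List.count_eq_zero.2 fun h => by
      obtain ⟨i, hi⟩ := mem_mkTuple s k a h
      exact ha i hi
    simp [hM, cnt, this]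
  let φ : (ℤ → ℤ) → RatFunc F := fun M => ((∑ a ∈ A, M a : ℤ) : RatFunc F)
  have hφ0 : φ 0 = 0 := by simp [φ]
  have hφ : ∀ M, ∀ a ∈ A, φ (M - eZ a) = φ M - 1 := by
    intro M a ha
    simp only [φ, Pi.sub_apply, Finset.sum_sub_distrib]
    have : ∑ b ∈ A, eZ a b = 1 := by
      rw [Finset.sum_eq_single a]
      · simp [eZ]
      · intro b _ hb; simp [eZ, hb]
      · exact fun h => absurd ha h
    rw [this]; push_cast; ring
  have hφM : φ M = ((∑ i, k i : ℕ) : RatFunc F) := by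
    have : ∑ a ∈ A, M a = ((∑ i, k i : ℕ) : ℤ) := by
      rw [← Finset.sum_subset (s₁ := Finset.univ.image s) Finset.subset_union_left]
      · rw [Finset.sum_image (fun _ _ _ _ h => hinj h)]
        simp [hMs]
      · intro a _ ha
        refine hM0 a fun i hi => ha ?_
        simp [hi]
    simp only [φ, this]
    push_cast; rfl
  have hH : ∀ N, ∑ a ∈ A, HH (Stilde v) A (2 * a) N (M - eZ a - eZ a) =
      ∑ i ∈ Finset.univ.filter fun i => 1 < k i,
        GG (Stilde v) A N (cnt (2 * s i :: mkTuple s (Function.update k i (k i - 2)))) := by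
    intro N
    rw [← Finset.sum_subset (s₁ := Finset.univ.image s) Finset.subset_union_left]
    · rw [Finset.sum_image (fun _ _ _ _ h => hinj h), Finset.sum_filter]
      refine Finset.sum_congr rfl fun i _ => ?_
      split_ifs with hi
      · have e1 : cnt (2 * s i :: mkTuple s (Function.update k i (k i - 2))) =
            cnt (mkTuple s (Function.update k i (k i - 2))) + eZ (2 * s i) := by
          funext a
          simp only [cnt, List.count_cons, Pi.add_apply, eZ]
          by_cases h : a = 2 * s i
          · subst h; simp
          · simp [h, Ne.symm h]
        have e2 : cnt (mkTuple s (Function.update k i (k i - 2))) = M - eZ (s i) - eZ (s i) := by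
          rw [hM, cnt_mkTuple, cnt_mkTuple, ← Finset.add_sum_erase _ _ (Finset.mem_univ i),
            ← Finset.add_sum_erase _ (fun j => (k j : ℤ) • eZ (s j)) (Finset.mem_univ i)]
          rw [Finset.sum_congr rfl (g := fun j => (k j : ℤ) • eZ (s j)) (by
            intro j hj
            rw [Function.update_of_ne (Finset.ne_of_mem_erase hj)])]
          rw [Function.update_self, Nat.cast_sub (by omega)]
          push_cast
          rw [sub_smul, two_smul]
          abel
        rw [e1, GG_eq_HH _ _ _ (hs2A i), e2]
        have : (mkTuple s (Function.update k i (k i - 2))).count (2 * s i) = 0 :=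
          List.count_eq_zero.2 fun h => by
            obtain ⟨j, hj⟩ := mem_mkTuple _ _ _ h
            exact hd2 i j hi hj
        simp [cnt, this]
      · refine HH_neg _ _ _ _ _ (s i) ?_
        simp only [Pi.sub_apply, hMs, eZ, Pi.single_eq_same]
        omega
    · intro a _ ha
      refine HH_neg _ _ _ _ _ a ?_
      have : M a = 0 := by
        refine hM0 a fun i hi => ha ?_
        simp [hi]
      simp only [Pi.sub_apply, this, eZ, Pi.single_eq_same]
      omega
  have hid := fun N => main_identity (Stilde v) (fun d a => Stilde_sq v d a) A φ hφ0 hφ N M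
  have hL : Filter.Tendsto (fun N => algebraMap (RatFunc F) (Kv v hv)
      (φ M * GG (Stilde v) A N M + ∑ a ∈ A, HH (Stilde v) A (2 * a) N (M - eZ a - eZ a)))
      Filter.atTop (nhds ((∑ i, k i) • Lsum (zetav v hv) (mkTuple s k) +
        ∑ i ∈ Finset.univ.filter fun i => 1 < k i,
        Lsum (zetav v hv) (2 * s i :: mkTuple s (Function.update k i (k i - 2))))) := by
    simp only [hH, hφM, map_add, map_mul, map_natCast, map_sum, nsmul_eq_mul]
    refine Filter.Tendsto.add (Filter.Tendsto.const_mul _ ?_) (tendsto_finsetSum _ fun i hi => ?_)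
    · refine tendsto_Lsum v hv A _ ?_ fun w hw => hsum w (Or.inl hw)
      intro a ha
      obtain ⟨i, rfl⟩ := mem_mkTuple _ _ _ ha
      exact hsA i
    · refine tendsto_Lsum v hv A _ ?_ fun w hw => hsum w (Or.inr ⟨i, by simpa using hi, hw⟩)
      intro a ha
      rw [List.mem_cons] at ha
      obtain rfl | ha := ha
      · exact hs2A i
      · obtain ⟨j, rfl⟩ := mem_mkTuple _ _ _ ha
        exact hsA j
  rw [add_comm]
  refine tendsto_nhds_unique hL (tendsto_zero_of_val v hv _ fun m hm => ?_)
  filter_upwards [Filter.eventually_gt_atTop (m * v.natDegree)] with N hN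
  rw [hid N]
  refine Valuation.map_sum_le _ fun a ha => ?_
  rw [map_mul, sum_DD_eq v hv hq2 N a (hAeven a ha)]
  exact (mul_le_mul' (val_sum_DD v hv N m hm hN (-a)) (val_GG v hv A N _)).trans (mul_one _).le

end Val


theorem statement1 {F : Type*} [Field F] [Fintype F] (q : ℕ) (hq : Fintype.card F = q)
    (hq2 : ∃ m : ℕ, q = 2 ^ m)
    (v : Polynomial F) (hvmonic : v.Monic) (hv : Irreducible v)
    (n : ℕ) (hn : 1 ≤ n) (s : Fin n → ℤ) (k : Fin n → ℕ) (hk : ∀ i, 1 ≤ k i)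
    (hinj : Function.Injective s)
    (hd2 : ∀ i j, 1 < k i → 2 * s i ≠ s j)
    (hd3 : ∀ i j, 1 < k i → 1 < k j → i ≠ j → 2 * s i ≠ 2 * s j)
    (heven : ∀ i, ((q : ℤ) - 1) ∣ s i)
    (hsum : ∀ w : List ℤ,
      (List.Perm w (mkTuple s k) ∨
        ∃ i, 1 < k i ∧
          List.Perm w (2 * s i :: mkTuple s (Function.update k i (k i - 2)))) →
      Summable (zetavTerm v hv w)) :
    (∑ i ∈ Finset.univ.filter fun i => 1 < k i,
        Lsum (zetav v hv) (2 * s i :: mkTuple s (Function.update k i (k i - 2))))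
      + (∑ i, k i) • Lsum (zetav v hv) (mkTuple s k) = 0 := by
  exact main_aux q hq hq2 v hv n s k hinj hd2 heven hsum

end
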